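/- arXiv:2405.10275 — 5 statements merged into one kernel-verified Lean document; each statement's English description precedes it below -/
import Mathlib

section
/- For integers n > t ≥ 0 and a set X with |X| ≥ 2, if every subfamily of at most 2^{t+1} balls from a finite family of Hamming balls of radius t in X^n has a common point, then all balls in the family have a common point. -/
open Finset

/-- Vectors admitting a family of functionals that is triangular with respect to some key are
linearly independent. -/
theorem linearIndependent_of_triangular {κ K V O : Type*} [Field K] [AddCommGroup V] [Module K V]
    [LinearOrder O] (v : κ → V) (w : κ → V →ₗ[K] K) (key : κ → O)
    (hdiag : ∀ x, w x (v x) ≠ 0)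
    (hoff : ∀ x y, x ≠ y → w y (v x) ≠ 0 → key x < key y) :
    LinearIndependent K v := by
  classical
  rw [linearIndependent_iff']
  intro s g hg i hi
  by_contra hgi
  obtain ⟨y, hy, hmin⟩ := exists_min_image (s.filter fun x => g x ≠ 0) key
    ⟨i, by simp [hi, hgi]⟩
  rw [mem_filter] at hy
  have hsum := congrArg (w y) hg
  rw [map_sum, map_zero, sum_eq_single_of_mem y hy.1] at hsum
  · simp [hy.2, hdiag y] at hsum
  · intro x hx hxy
    rw [map_smul, smul_eq_mul]
    by_contra hne
    have hgx := left_ne_zero_of_mul hne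
    have hlt := hoff x y hxy (right_ne_zero_of_mul hne)
    exact (hmin x (by simp [hx, hgx])).not_gt hlt

/-- Finite sets ordered by cardinality, ties being broken by the reversed colexicographic order. -/
def cardColexKey {n : ℕ} (F : Finset (Fin n)) : ℕ ×ₗ (Colex (Finset (Fin n)))ᵒᵈ :=
  toLex (#F, OrderDual.toDual (toColex F))

theorem cardColexKey_injective {n : ℕ} :
    Function.Injective (cardColexKey : Finset (Fin n) → _) := by
  intro F G h
  have h' := congrArg (fun p => (ofLex p).2) h
  simpa [cardColexKey] using h'

theorem cardColexKey_lt {n : ℕ} {F G : Finset (Fin n)} :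
    cardColexKey F < cardColexKey G ↔ #F < #G ∨ #F = #G ∧ toColex G < toColex F := by
  simp [cardColexKey, Prod.Lex.toLex_lt_toLex]

/-- A set `F` that precedes `F ∆ E` also precedes every `G` such that `D ∪ F ∆ E` can be covered
by `G` and at most `#D` further elements. -/
theorem cardColexKey_lt_of_subset {n : ℕ} {D E F G T : Finset (Fin n)} {μ : Fin n}
    (hDE : Disjoint D E) (hμ : μ ∈ E) (hmax : ∀ k ∈ D ∪ E, k ≤ μ) (hF : Disjoint F D)
    (hgood : cardColexKey F < cardColexKey (symmDiff F E)) (hT : #T ≤ #D)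
    (hsub : D ∪ symmDiff F E ⊆ T ∪ G) : cardColexKey F < cardColexKey G := by
  have hdisj : Disjoint D (symmDiff F E) := by
    rw [disjoint_left] at *
    intro k hk hk'
    rw [mem_symmDiff] at hk'
    rcases hk' with h | h
    · exact hF h.1 hk
    · exact hDE hk h.1
  have hcard : #D + #(symmDiff F E) = #(D ∪ symmDiff F E) := (card_union_of_disjoint hdisj).symm
  have hle : #(D ∪ symmDiff F E) ≤ #(T ∪ G) := card_le_card hsub
  have hTG : #(T ∪ G) ≤ #T + #G := card_union_le T G
  rw [cardColexKey_lt] at *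
  rcases hgood with h | ⟨h, hlt⟩
  · left; omega
  rcases Nat.lt_or_ge (#F) (#G) with hFG | hFG
  · exact Or.inl hFG
  refine Or.inr ⟨by omega, ?_⟩
  have heq : D ∪ symmDiff F E = T ∪ G := eq_of_subset_of_card_le hsub (by omega)
  have hG : ∀ k ∈ G, k ∈ D ∪ symmDiff F E := fun k hk => heq ▸ mem_union_right T hk
  have hμD : μ ∉ D := fun hμ' => disjoint_left.1 hDE hμ' hμ
  have hμF : μ ∈ F := by
    by_contra hμF
    refine hlt.not_gt ?_
    rw [Colex.toColex_lt_toColex]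
    refine ⟨fun h => ?_, fun k hk hk' => ⟨μ, ?_, hμF, hmax k ?_⟩⟩
    · exact hμF (by rw [h]; simp [mem_symmDiff, hμ, hμF])
    · simp [mem_symmDiff, hμ, hμF]
    · simp only [mem_symmDiff, not_or, not_and, not_not] at hk'
      exact mem_union_right _ (hk'.1 hk)
  have hμG : μ ∉ G := fun h => by
    have := hG μ h
    simp [mem_symmDiff, hμ, hμF, hμD] at this
  rw [Colex.toColex_lt_toColex]
  refine ⟨fun h => hμG (h ▸ hμF), fun k hk hk' => ⟨μ, hμF, hμG, hmax k ?_⟩⟩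
  have := hG k hk
  simp only [mem_union, mem_symmDiff, hk', false_and, false_or] at this
  simp only [mem_union]
  tauto

/-- Exactly half of the sets avoiding `D` precede their symmetric difference with `E`. -/
theorem card_precedes_symmDiff {n : ℕ} {D E : Finset (Fin n)} (hDE : Disjoint D E)
    (hE : E.Nonempty) :
    2 * #{F : Finset (Fin n) | Disjoint F D ∧ cardColexKey F < cardColexKey (symmDiff F E)}
      = 2 ^ (n - #D) := by
  have hinv : ∀ F : Finset (Fin n), Disjoint F D → Disjoint (symmDiff F E) D := by
    intro F hF
    rw [disjoint_left] at *
    intro k hk hk'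
    rw [mem_symmDiff] at hk
    rcases hk with h | h
    · exact hF h.1 hk'
    · exact hDE hk' h.1
  have hne : ∀ F : Finset (Fin n), cardColexKey F ≠ cardColexKey (symmDiff F E) := by
    intro F h
    have h' := (symmDiff_eq_left.1 (cardColexKey_injective h).symm)
    simp [h'] at hE
  have hswap :
      #{F : Finset (Fin n) | Disjoint F D ∧ cardColexKey F < cardColexKey (symmDiff F E)}
      = #{F : Finset (Fin n) | Disjoint F D ∧ ¬ cardColexKey F < cardColexKey (symmDiff F E)} := by
    refine card_bij' (fun F _ => symmDiff F E) (fun F _ => symmDiff F E) ?_ ?_ ?_ ?_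
    · intro F hF
      simp only [mem_filter, mem_univ, true_and, symmDiff_symmDiff_cancel_right] at hF ⊢
      exact ⟨hinv F hF.1, hF.2.not_gt⟩
    · intro F hF
      simp only [mem_filter, mem_univ, true_and, symmDiff_symmDiff_cancel_right] at hF ⊢
      exact ⟨hinv F hF.1, lt_of_le_of_ne (not_lt.1 hF.2) (hne F).symm⟩
    · intro F _; simp
    · intro F _; simp
  have htotal : #{F : Finset (Fin n) | Disjoint F D} = 2 ^ (n - #D) := by
    have : ({F : Finset (Fin n) | Disjoint F D} : Finset _) = Dᶜ.powerset := by
      ext F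
      simp [subset_compl_iff_disjoint_right]
    rw [this, card_powerset, card_compl, Fintype.card_fin]
  have hsplit := card_filter_add_card_filter_not (s := {F : Finset (Fin n) | Disjoint F D})
    (fun F => cardColexKey F < cardColexKey (symmDiff F E))
  rw [filter_filter, filter_filter] at hsplit
  omega

/-- The pure tensor with prescribed factors in `K²`, as a function on the binary cube. -/
def pureTensor {n : ℕ} {K : Type*} [Field K] (u : Fin n → Fin 2 → K) : (Fin n → Fin 2) → K :=
  fun p => ∏ k, u k (p k)

theorem pureTensor_dotProduct {n : ℕ} {K : Type*} [Field K] (u v : Fin n → Fin 2 → K) :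
    pureTensor u ⬝ᵥ pureTensor v = ∏ k, (u k 0 * v k 0 + u k 1 * v k 1) := by
  simp only [dotProduct, pureTensor, ← prod_mul_distrib]
  rw [← Fintype.prod_sum (fun k e => u k e * v k e)]
  simp only [Fin.sum_univ_two]

section Factors

variable {n : ℕ} {K : Type*} [Field K]

/-- The factors `y - a`, `y - b` or `1`, written as coefficient vectors of polynomials in `y`. -/
def polyFactor (a b : Fin n → K) (D E F : Finset (Fin n)) (k : Fin n) : Fin 2 → K :=
  if k ∈ D ∪ symmDiff F E then ![-a k, 1] else if k ∈ E then ![-b k, 1] else ![1, 0]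

/-- The functionals dual to `polyFactor`: evaluation at `b`, evaluation at `a`, or derivative. -/
def dualFactor (a b : Fin n → K) (E F : Finset (Fin n)) (k : Fin n) : Fin 2 → K :=
  if k ∉ F then ![1, b k] else if k ∈ E then ![1, a k] else ![0, 1]

theorem polyFactor_dualFactor_self {a b : Fin n → K} {D E F : Finset (Fin n)}
    (hab : ∀ k, k ∈ D ∪ E ↔ a k ≠ b k) (hF : Disjoint F D) :
    pureTensor (polyFactor a b D E F) ⬝ᵥ pureTensor (dualFactor a b E F) ≠ 0 := by
  rw [pureTensor_dotProduct, prod_ne_zero_iff]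
  intro k _
  have h1 := hab k
  have h2 : k ∈ F → k ∉ D := fun h => disjoint_left.1 hF h
  simp only [mem_union] at h1
  by_cases hkF : k ∈ F <;> by_cases hkE : k ∈ E <;> by_cases hkD : k ∈ D <;>
    simp_all [polyFactor, dualFactor, mem_symmDiff, neg_add_eq_zero, eq_comm]

theorem polyFactor_dualFactor_of_ne {a b : Fin n → K} {D E F G : Finset (Fin n)}
    (hab : ∀ k, k ∈ D ∪ E ↔ a k ≠ b k) (hF : Disjoint F D)
    (hG : Disjoint G D) (hne : F ≠ G) :
    pureTensor (polyFactor a b D E F) ⬝ᵥ pureTensor (dualFactor a b E G) = 0 := by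
  obtain ⟨k, hk⟩ := symmDiff_nonempty.2 hne
  rw [pureTensor_dotProduct]
  refine prod_eq_zero (mem_univ k) ?_
  have h1 := hab k
  have h2 : k ∈ F → k ∉ D := fun h => disjoint_left.1 hF h
  have h3 : k ∈ G → k ∉ D := fun h => disjoint_left.1 hG h
  rw [mem_symmDiff] at hk
  simp only [mem_union] at h1
  by_cases hkF : k ∈ F <;> by_cases hkG : k ∈ G <;> by_cases hkE : k ∈ E <;>
    simp_all [polyFactor, dualFactor, mem_symmDiff]

theorem subset_of_polyFactor_dualFactor_ne_zero {a b a₂ b₂ : Fin n → K}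
    {D E F E₂ G T : Finset (Fin n)} (hT : ∀ k, a k ≠ b₂ k → k ∈ T)
    (h : pureTensor (polyFactor a b D E F) ⬝ᵥ pureTensor (dualFactor a₂ b₂ E₂ G) ≠ 0) :
    D ∪ symmDiff F E ⊆ T ∪ G := by
  intro k hk
  by_contra hkT
  rw [mem_union, not_or] at hkT
  refine h ?_
  rw [pureTensor_dotProduct]
  refine prod_eq_zero (mem_univ k) ?_
  have hab : a k = b₂ k := by
    by_contra hne
    exact hkT.1 (hT k hne)
  rw [polyFactor, if_pos hk, dualFactor, if_pos hkT.2]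
  simp [hab]

end Factors

theorem exists_split_of_lt_card {n t : ℕ} (d : Finset (Fin n)) (h : t < #d) :
    ∃ D E : Finset (Fin n), ∃ μ, D ∪ E = d ∧ Disjoint D E ∧ #D = t ∧ μ ∈ E ∧
      ∀ k ∈ D ∪ E, k ≤ μ := by
  have hne : d.Nonempty := card_pos.1 (by omega)
  have hmem := d.max'_mem hne
  obtain ⟨D, hD, hcard⟩ := exists_subset_card_eq
    (show t ≤ #(d.erase (d.max' hne)) by rw [card_erase_of_mem hmem]; omega)
  have hDd : D ⊆ d := hD.trans (erase_subset _ _)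
  refine ⟨D, d \ D, d.max' hne, union_sdiff_of_subset hDd, disjoint_sdiff, hcard, ?_, ?_⟩
  · exact mem_sdiff.2 ⟨hmem, fun h => (mem_erase.1 (hD h)).1 rfl⟩
  · intro k hk
    rw [union_sdiff_of_subset hDd] at hk
    exact d.le_max' k hk

theorem exists_field_embedding.{u} (X : Type u) :
    ∃ (K : Type u) (_ : Field K) (φ : X → K), Function.Injective φ :=
  ⟨FractionRing (MvPolynomial X ℚ), inferInstance,
    fun x => algebraMap (MvPolynomial X ℚ) _ (MvPolynomial.X x),
    (IsFractionRing.injective (MvPolynomial X ℚ) _).comp MvPolynomial.X_injective⟩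

/-- If `a i` and `b j` are at distance at most `t` exactly when `i ≠ j`, then there are at most
`2 ^ (t + 1)` indices. -/
theorem card_le_two_pow_of_hammingDist {ι X : Type*} [Fintype ι] [DecidableEq X] {n t : ℕ}
    (a b : ι → Fin n → X) (hdiag : ∀ i, t < hammingDist (a i) (b i))
    (hoff : ∀ i j, i ≠ j → hammingDist (a i) (b j) ≤ t) : Fintype.card ι ≤ 2 ^ (t + 1) := by
  classical
  rcases isEmpty_or_nonempty ι with _ | ⟨⟨i₀⟩⟩
  · simp
  have htn : t < n := (hdiag i₀).trans_le
    (by simpa using hammingDist_le_card_fintype (x := a i₀) (y := b i₀))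
  obtain ⟨K, _, φ, hφ⟩ := exists_field_embedding X
  choose D E μ hd hDE hDcard hμ hmax using fun i =>
    exists_split_of_lt_card ({k | a i k ≠ b i k} : Finset (Fin n)) (hdiag i)
  have hab : ∀ i k, k ∈ D i ∪ E i ↔ φ (a i k) ≠ φ (b i k) := by
    intro i k
    rw [hd, hφ.ne_iff]
    simp
  let good (i : ι) : Finset (Finset (Fin n)) :=
    {F | Disjoint F (D i) ∧ cardColexKey F < cardColexKey (symmDiff F (E i))}
  have hgood : ∀ i, ∀ F ∈ good i, Disjoint F (D i) ∧
      cardColexKey F < cardColexKey (symmDiff F (E i)) := fun i F hF => (mem_filter.1 hF).2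
  have hcard : ∀ i, #(good i) = 2 ^ (n - (t + 1)) := by
    intro i
    have h := card_precedes_symmDiff (hDE i) ⟨μ i, hμ i⟩
    rw [hDcard, show n - t = n - (t + 1) + 1 by omega, pow_succ] at h
    change 2 * #(good i) = _ at h
    omega
  let row (x : Σ i, good i) : (Fin n → Fin 2) → K :=
    pureTensor (polyFactor (φ ∘ a x.1) (φ ∘ b x.1) (D x.1) (E x.1) x.2)
  let col (x : Σ i, good i) : (Fin n → Fin 2) → K :=
    pureTensor (dualFactor (φ ∘ a x.1) (φ ∘ b x.1) (E x.1) x.2)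
  have hind : LinearIndependent K row := by
    refine linearIndependent_of_triangular row
      (fun x => (dotProductBilin K K).flip (col x)) (fun x => cardColexKey (x.2 : Finset (Fin n)))
      ?_ ?_
    · rintro ⟨i, F, hF⟩
      exact polyFactor_dualFactor_self (hab i) (hgood i F hF).1
    · rintro ⟨i, F, hF⟩ ⟨j, G, hG⟩ hne hpair
      change row ⟨i, F, hF⟩ ⬝ᵥ col ⟨j, G, hG⟩ ≠ 0 at hpair
      by_cases hij : i = j
      · subst hij
        have hFG : F ≠ G := by
          rintro rfl
          exact hne rfl
        exact absurd (polyFactor_dualFactor_of_ne (hab i) (hgood i F hF).1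
          (hgood i G hG).1 hFG) hpair
      · refine cardColexKey_lt_of_subset (hDE i) (hμ i) (hmax i) (hgood i F hF).1
          (hgood i F hF).2 (T := {k | a i k ≠ b j k}) ?_
          (subset_of_polyFactor_dualFactor_ne_zero ?_ hpair)
        · rw [hDcard]
          exact hoff i j hij
        · intro k hk
          simpa using fun h => hk (congrArg φ h)
  have hfin := hind.fintype_card_le_finrank
  simp only [Fintype.card_sigma, Fintype.card_coe, hcard, sum_const, card_univ, smul_eq_mul,
    Module.finrank_fintype_fun_eq_card, Fintype.card_fun, Fintype.card_fin] at hfin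
  refine Nat.le_of_mul_le_mul_right (hfin.trans_eq ?_) (Nat.two_pow_pos (n - (t + 1)))
  rw [← pow_add]
  congr 1
  omega

theorem stmt_1 (n t : ℕ) (ht : t < n) (X : Type*) [DecidableEq X]
    (hX : ∃ x y : X, x ≠ y) (m : ℕ) (c : Fin m → (Fin n → X))
    (h : ∀ S : Finset (Fin m), S.card ≤ 2 ^ (t + 1) →
      ∃ p : Fin n → X, ∀ i ∈ S, hammingDist p (c i) ≤ t) :
    ∃ p : Fin n → X, ∀ i, hammingDist p (c i) ≤ t := by
  classical
  suffices hall : ∀ S : Finset (Fin m), ∃ p : Fin n → X, ∀ i ∈ S, hammingDist p (c i) ≤ t by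
    simpa using hall univ
  intro S
  induction S using Finset.strongInduction with
  | H S ih =>
    by_contra hS
    choose p hp using fun i : S => ih (S.erase i) (erase_ssubset i.2)
    have hcard : Fintype.card S ≤ 2 ^ (t + 1) := by
      refine card_le_two_pow_of_hammingDist p (fun i => c i) (fun i => ?_) (fun i j hij => ?_)
      · by_contra hi
        refine hS ⟨p i, fun j hj => ?_⟩
        by_cases hji : j = i
        · exact hji ▸ not_lt.1 hi
        · exact hp i j (mem_erase.2 ⟨hji, hj⟩)
      · exact hp i j (mem_erase.2 ⟨fun h => hij (Subtype.ext h.symm), j.2⟩)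
    exact hS (h S (by simpa using hcard))
end

section
/- Let n > t ≥ 0 and let X be a nonempty set. Suppose a_1,…,a_m, b_1,…,b_m ∈ X^n satisfy dist(a_i,b_i) ≥ t+1 for all i ∈ [m] and dist(a_i,b_j) ≤ t for all distinct i,j ∈ [m]. Then m ≤ 2^{t+1}. -/
namespace HammingPairs

open AddMonoidAlgebra

lemma hammingNorm_add_le {ι : Type*} [Fintype ι] (g h : ι → ZMod 2) :
    hammingNorm (g + h) ≤ hammingNorm g + hammingNorm h := by
  have := hammingDist_triangle (g + h) h 0
  rw [hammingDist_zero_right, hammingDist_zero_right, hammingDist_comm, hammingDist_eq_hammingNorm]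
    at this
  simpa using this

variable {R S ι κ : Type*} [CommRing R] [CommRing S] [Fintype ι] [DecidableEq ι]

/-- The linear form `∑ i, c i • e i` in the group algebra of `(ℤ/2)^ι`, where `e i = 1 + g i` and
`g i` is the `i`-th standard generator. In characteristic two, `e i ^ 2 = 0`. -/
noncomputable def linearForm (c : ι → R) : AddMonoidAlgebra R (ι → ZMod 2) :=
  ∑ i, c i • (1 + single (Pi.single i 1) 1)

lemma linearForm_mul_self [CharP R 2] (c : ι → R) : linearForm c * linearForm c = 0 := by
  have : CharP (AddMonoidAlgebra R (ι → ZMod 2)) 2 := by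
    refine charP_of_injective_ringHom (f := singleZeroRingHom) ?_ 2
    exact fun x y h => single_right_inj.1 h
  rw [linearForm, CharTwo.sum_mul_self]
  refine Finset.sum_eq_zero fun i _ => ?_
  rw [smul_mul_smul_comm, CharTwo.add_mul_self, single_mul_single, ← Pi.single_add,
    CharTwo.add_self_eq_zero, Pi.single_zero, one_mul, one_mul, ← one_def,
    CharTwo.add_self_eq_zero, smul_zero]

lemma one_add_smul_linearForm_mul [CharP R 2] (c : ι → R) (x y : R) :
    (1 + x • linearForm c) * (1 + y • linearForm c) = 1 + (x + y) • linearForm c := by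
  have h : (x • linearForm c) * (y • linearForm c) = 0 := by
    rw [smul_mul_smul_comm, linearForm_mul_self, smul_zero]
  rw [add_mul, mul_add, mul_add, h, add_smul]
  simp only [one_mul, mul_one, add_zero]
  abel

lemma map_linearForm (f : R →+* S) (c : ι → R) :
    mapRingHom (ι → ZMod 2) f (linearForm c) = linearForm (fun i => f (c i)) := by
  ext m
  simp [linearForm, one_def, Finsupp.single_apply]

lemma map_smul_linearForm (f : R →+* S) (x : R) (c : ι → R) :
    mapRingHom (ι → ZMod 2) f (x • linearForm c) = f x • linearForm (fun i => f (c i)) := by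
  rw [← map_linearForm]
  ext m
  simp [coeff_mapRingHom]

lemma hammingNorm_le_one_of_coeff_ne_zero (x : R) (c : ι → R) (h : ι → ZMod 2)
    (hh : (1 + x • linearForm c).coeff h ≠ 0) : hammingNorm h ≤ 1 := by
  contrapose! hh
  have h0 : 0 ≠ h := by
    rintro rfl
    simp at hh
  have hs : ∀ i : ι, Pi.single i (1 : ZMod 2) ≠ h := by
    rintro i rfl
    refine absurd hh (not_lt.2 ?_)
    rw [hammingNorm, Finset.card_le_one]
    intro j hj k hk
    simp only [Finset.mem_filter, Finset.mem_univ, true_and, Pi.single_apply] at hj hk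
    grind
  simp [linearForm, one_def, h0, hs]

lemma hammingNorm_le_card_of_coeff_prod_ne_zero (D : Finset κ) (x : κ → R) (c : κ → ι → R)
    (h : ι → ZMod 2) (hh : (∏ k ∈ D, (1 + x k • linearForm (c k))).coeff h ≠ 0) :
    hammingNorm h ≤ D.card := by
  classical
  induction D using Finset.induction_on generalizing h with
  | empty =>
    by_cases h0 : 0 = h
    · simp [← h0]
    · simp [one_def, h0] at hh
  | insert k D hk ih =>
    rw [Finset.prod_insert hk] at hh
    obtain ⟨g₁, hg₁, g₂, hg₂, rfl⟩ :=
      Finset.mem_add.1 (support_coeff_mul_subset _ _ (Finsupp.mem_support_iff.2 hh))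
    rw [Finset.card_insert_of_notMem hk]
    have h₁ := hammingNorm_le_one_of_coeff_ne_zero _ _ _ (Finsupp.mem_support_iff.1 hg₁)
    have h₂ := ih _ (Finsupp.mem_support_iff.1 hg₂)
    have := hammingNorm_add_le g₁ g₂
    omega

lemma coeff_prod_eq_zero [Fintype κ] (x : κ → R) (c : κ → ι → R) (D : Finset κ)
    (hx : ∀ k ∉ D, x k = 0) (hD : D.card < Fintype.card ι) :
    (∏ k, (1 + x k • linearForm (c k))).coeff (1 : ι → ZMod 2) = 0 := by
  by_contra hne
  rw [← Finset.prod_subset (Finset.subset_univ D) fun k _ hk => by simp [hx k hk]] at hne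
  have := hammingNorm_le_card_of_coeff_prod_ne_zero D x c 1 hne
  have h1 : hammingNorm (1 : ι → ZMod 2) = Fintype.card ι := by simp [hammingNorm]
  omega

lemma coeff_prod_unit (y : ι → R) :
    (∏ i, (1 + y i • (1 + single (Pi.single i 1) 1 : AddMonoidAlgebra R (ι → ZMod 2)))).coeff 1 =
      ∏ i, y i := by
  have e : ∀ i, (1 + y i • (1 + single (Pi.single i 1) 1 : AddMonoidAlgebra R (ι → ZMod 2))) =
      single (Pi.single i 1) (y i) + single 0 (1 + y i) := by
    intro i
    rw [single_add, ← one_def, smul_add, one_def, smul_single, smul_single]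
    simp only [smul_eq_mul, mul_one]
    abel
  simp_rw [e, Finset.prod_add, prod_single, single_mul_single, coeff_sum, Finsupp.finsetSum_apply,
    coeff_single]
  rw [Finset.sum_eq_single Finset.univ]
  · rw [Finset.sum_const_zero, add_zero, show ∑ i, Pi.single i 1 = (1 : ι → ZMod 2) from
      Finset.univ_sum_single (1 : ι → ZMod 2)]
    simp
  · intro T _ hT
    refine Finsupp.single_eq_of_ne fun h => hT (Finset.eq_univ_iff_forall.2 fun i => ?_)
    by_contra hi
    have := congrFun h i
    rw [Finset.sum_const_zero, add_zero, Finset.sum_apply] at this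
    simp [Finset.sum_pi_single, hi] at this
  · simp

lemma coeff_prod_embedding [Fintype κ] [DecidableEq κ] (x : κ → R) (s : ι ↪ κ) :
    (∏ k, (1 + x k • linearForm (fun i => if k = s i then (1 : R) else 0))).coeff
      (1 : ι → ZMod 2) = ∏ i, x (s i) := by
  rw [← coeff_prod_unit fun i => x (s i),
    ← Finset.prod_subset (Finset.subset_univ (Finset.univ.map s))]
  · rw [Finset.prod_map]
    simp only [linearForm, s.injective.eq_iff, ite_smul, one_smul, zero_smul, Finset.sum_ite_eq,
      Finset.mem_univ, if_true]
  · intro k _ hk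
    have : ∀ i, k ≠ s i := fun i h => hk (by simp [h])
    simp [linearForm, this]

lemma coeff_prod_ne_zero [Fintype κ] [DecidableEq κ] {X : Type*} [DecidableEq X] (a b : κ → X)
    (h : Fintype.card ι ≤ hammingDist a b) :
    (∏ k, (1 + (MvPolynomial.X (Sum.inl (a k)) + MvPolynomial.X (Sum.inl (b k)) :
      MvPolynomial (X ⊕ κ × ι) (ZMod 2)) •
        linearForm (fun i : ι => (MvPolynomial.X (Sum.inr (k, i)) :
          MvPolynomial (X ⊕ κ × ι) (ZMod 2))))).coeff (1 : ι → ZMod 2) ≠ 0 := by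
  obtain ⟨s, hs⟩ : ∃ s : ι ↪ κ, ∀ i, a (s i) ≠ b (s i) := by
    have : Fintype.card ι ≤ Fintype.card {k // a k ≠ b k} := by
      rwa [Fintype.card_subtype]
    obtain ⟨s⟩ := Function.Embedding.nonempty_of_card_le this
    exact ⟨s.trans (Function.Embedding.subtype _), fun i => (s i).2⟩
  let f : MvPolynomial (X ⊕ κ × ι) (ZMod 2) →+* MvPolynomial X (ZMod 2) :=
    (MvPolynomial.aeval (Sum.elim MvPolynomial.X
      fun p : κ × ι => if p.1 = s p.2 then 1 else 0)).toRingHom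
  intro h0
  have h1 := congrArg f h0
  rw [← coeff_mapRingHom, map_prod] at h1
  simp_rw [map_add, map_one, map_smul_linearForm] at h1
  have hl : ∀ x, f (MvPolynomial.X (Sum.inl x)) = MvPolynomial.X x := fun x => by simp [f]
  have hr : ∀ k i, f (MvPolynomial.X (Sum.inr (k, i))) = if k = s i then 1 else 0 :=
    fun k i => by simp [f]
  simp_rw [map_add, hl, hr, map_zero] at h1
  rw [coeff_prod_embedding (fun k => MvPolynomial.X (a k) + MvPolynomial.X (b k)) s,
    Finset.prod_eq_zero_iff] at h1
  obtain ⟨i, -, hi⟩ := h1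
  exact hs i (MvPolynomial.X_injective (CharTwo.add_eq_zero.1 hi))

lemma linearIndependent_of_mul_functional {A : Type*} [IsDomain R] [CommRing A] [Algebra R A]
    (φ : A →ₗ[R] R) (u v : κ → A) (hd : ∀ i, φ (u i * v i) ≠ 0)
    (ho : ∀ i j, i ≠ j → φ (u i * v j) = 0) : LinearIndependent R u := by
  rw [linearIndependent_iff']
  intro s g hg j hj
  have h := congrArg (fun z => φ (z * v j)) hg
  simp only [Finset.sum_mul, smul_mul_assoc, map_sum, map_smul, zero_mul, map_zero] at h
  rw [Finset.sum_eq_single j (fun i _ hij => by rw [ho i j hij, smul_zero])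
    (fun hj' => absurd hj hj')] at h
  exact (mul_eq_zero.1 h).resolve_right (hd j)

end HammingPairs

open HammingPairs in
theorem stmt_3 (n t : ℕ) (ht : t < n) (X : Type*) [DecidableEq X] [Nonempty X]
    (m : ℕ) (a b : Fin m → (Fin n → X))
    (h1 : ∀ i, t + 1 ≤ hammingDist (a i) (b i))
    (h2 : ∀ i j, i ≠ j → hammingDist (a i) (b j) ≤ t) :
    m ≤ 2 ^ (t + 1) := by
  let P := MvPolynomial (X ⊕ Fin n × Fin (t + 1)) (ZMod 2)
  let G := Fin (t + 1) → ZMod 2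
  let u (p : Fin n → X) : AddMonoidAlgebra P G :=
    ∏ k, (1 + (MvPolynomial.X (Sum.inl (p k)) : P) •
      linearForm (fun i => MvPolynomial.X (Sum.inr (k, i))))
  let φ : AddMonoidAlgebra P G →ₗ[P] P :=
    Finsupp.lapply 1 ∘ₗ (AddMonoidAlgebra.coeffLinearEquiv P).toLinearMap
  have : CharP P 2 := inferInstanceAs (CharP (MvPolynomial _ (ZMod 2)) 2)
  have hmul (p q : Fin n → X) : φ (u p * u q) =
      (∏ k, (1 + (MvPolynomial.X (Sum.inl (p k)) + MvPolynomial.X (Sum.inl (q k)) : P) •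
        linearForm (fun i => MvPolynomial.X (Sum.inr (k, i))))).coeff (1 : G) := by
    simp_rw [u, ← Finset.prod_mul_distrib]
    rw [Finset.prod_congr rfl fun k _ => one_add_smul_linearForm_mul (R := P) _ _ _]
    rfl
  have hli : LinearIndependent P fun i => u (a i) := by
    refine linearIndependent_of_mul_functional φ _ (fun i => u (b i)) (fun i => ?_)
      fun i j hij => ?_
    · rw [hmul]
      exact coeff_prod_ne_zero _ _ (by simpa using h1 i)
    · rw [hmul]
      refine coeff_prod_eq_zero _ _ {k | a i k ≠ b j k} (fun k hk => ?_) ?_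
      · have : a i k = b j k := by simpa using hk
        rw [this, CharTwo.add_self_eq_zero]
      · simpa [hammingDist] using Nat.lt_succ_of_le (h2 i j hij)
  have hbasis := AddMonoidAlgebra.basis G P
  have : Module.Finite P (AddMonoidAlgebra P G) := Module.Finite.of_basis hbasis
  have hcard := hli.fintype_card_le_finrank
  rw [Module.finrank_eq_card_basis hbasis] at hcard
  simpa [G, ZMod.card] using hcard
end

section
/- Let n > t ≥ s ≥ 1. Define V_{N,d} = sum_{i=0}^{(d-1)/2} C(N,i) if d is odd, and V_{N,d} = sum_{i=0}^{d/2−1} C(N,i) + C(N−1, d/2−1) if d is even. Suppose a_1,…,a_m, b_1,…,b_m ∈ X^n, where X is any nonempty set, satisfy dist(a_i,b_i) ≥ t+s for all i ∈ [m] and dist(a_i,b_j) ≤ t for all distinct i,j ∈ [m]. Then m ≤ 2^{t+s}/V_{t+s,s}. -/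
/-- `V N d` from the paper: size of a Hamming-ball-like region. -/
def V (N d : ℕ) : ℕ :=
  if d % 2 = 1 then ∑ i ∈ Finset.range ((d - 1) / 2 + 1), N.choose i
  else (∑ i ∈ Finset.range (d / 2), N.choose i) + (N - 1).choose (d / 2 - 1)

open Finset

/-- Vectors that pair triangularly with a family of functionals, in the sense that the diagonal
pairings are nonzero and the off-diagonal ones vanish unless a rank strictly increases, are
linearly independent. -/
theorem linearIndependent_of_triangular_pairing {R K W L : Type*} [Finite R] [Field K]
    [AddCommGroup W] [Module K W] [PartialOrder L] (x : R → W) (y : R → W →ₗ[K] K) (ρ : R → L)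
    (hdiag : ∀ r, y r (x r) ≠ 0)
    (hoff : ∀ r c, r ≠ c → y c (x r) ≠ 0 → ρ r < ρ c) :
    LinearIndependent K x := by
  classical
  have := Fintype.ofFinite R
  rw [Fintype.linearIndependent_iff]
  intro g hg
  by_contra! hne
  obtain ⟨r₀, hr₀⟩ := hne
  obtain ⟨c, hc⟩ := (Finset.univ.filter fun r => g r ≠ 0).exists_minimalFor ρ ⟨r₀, by simp [hr₀]⟩
  have hgc : g c ≠ 0 := by simpa using hc.1
  have h := congrArg (y c) hg
  rw [map_sum, map_zero, Finset.sum_eq_single c] at h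
  · rw [map_smul, smul_eq_mul] at h
    exact mul_ne_zero hgc (hdiag c) h
  · intro r _ hrc
    by_cases hgr : g r = 0
    · simp [hgr]
    · have : y c (x r) = 0 := by
        by_contra hy
        have hlt := hoff r c hrc hy
        exact absurd (hc.2 (by simpa using hgr) hlt.le) hlt.not_ge
      simp [this]
  · simp

/-- A skew set-pair inequality for words: if `p r` and `q r` differ everywhere, while for `r ≠ c`
the words `p r` and `q c` agree somewhere unless a rank strictly increases from `r` to `c`, then
there are at most `2 ^ n` pairs. -/
theorem card_le_two_pow_of_skew_words {R Y L : Type*} [Fintype R] [PartialOrder L] {n : ℕ}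
    (p q : R → Fin n → Y) (ρ : R → L)
    (hdiag : ∀ r k, p r k ≠ q r k)
    (hoff : ∀ r c, r ≠ c → (∀ k, p r k ≠ q c k) → ρ r < ρ c) :
    Fintype.card R ≤ 2 ^ n := by
  classical
  let K := FractionRing (MvPolynomial Y ℚ)
  let emb : Y → K := fun z => algebraMap (MvPolynomial Y ℚ) K (MvPolynomial.X z)
  have hemb : Function.Injective emb :=
    (IsFractionRing.injective (MvPolynomial Y ℚ) K).comp MvPolynomial.X_injective
  let v : Y → Bool → K := fun z β => if β then emb z else 1
  let w : Y → Bool → K := fun z β => if β then -1 else emb z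
  let x : R → (Fin n → Bool) → K := fun r S => ∏ k, v (p r k) (S k)
  let y : R → ((Fin n → Bool) → K) →ₗ[K] K := fun c =>
    Fintype.linearCombination K fun S => ∏ k, w (q c k) (S k)
  have hpair : ∀ r c, y c (x r) = ∏ k, (emb (q c k) - emb (p r k)) := by
    intro r c
    have h : ∀ k, emb (q c k) - emb (p r k) = ∑ β, v (p r k) β * w (q c k) β := by
      intro k
      simp only [Fintype.sum_bool, v, w]
      simp
      ring
    rw [Finset.prod_congr rfl fun k _ => h k, Finset.prod_univ_sum, Fintype.piFinset_univ]
    simp only [y, x, Fintype.linearCombination_apply, Finset.prod_mul_distrib, smul_eq_mul]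
  have hpair_ne : ∀ r c, y c (x r) ≠ 0 ↔ ∀ k, p r k ≠ q c k := by
    intro r c
    rw [hpair, Finset.prod_ne_zero_iff]
    simp only [Finset.mem_univ, true_implies, sub_ne_zero, hemb.ne_iff]
    exact forall_congr' fun k => ne_comm
  have hli := linearIndependent_of_triangular_pairing x y ρ
    (fun r => (hpair_ne r r).2 (hdiag r)) (fun r c hrc h => hoff r c hrc ((hpair_ne r c).1 h))
  simpa using hli.fintype_card_le_finrank

theorem sum_range_choose_succ (N q : ℕ) :
    ∑ i ∈ range (q + 1), (N + 1).choose i =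
      ∑ i ∈ range (q + 1), N.choose i + ∑ i ∈ range q, N.choose i := by
  rw [Finset.sum_range_succ', Finset.sum_range_succ' (fun i => N.choose i) q]
  simp only [Nat.choose_succ_succ, Finset.sum_add_distrib, Nat.choose_zero_right]
  ring

/-- The density of the Hamming ball of radius `r` in dimension `t + 2 r + 1` increases with `r`. -/
theorem ball_density_mono {t k r : ℕ} (ht : 1 ≤ t) (hkr : k ≤ r) :
    2 ^ (t + 2 * r + 1) * ∑ i ∈ range (k + 1), (t + 2 * k + 1).choose i ≤
      2 ^ (t + 2 * k + 1) * ∑ i ∈ range (r + 1), (t + 2 * r + 1).choose i := by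
  induction r, hkr using Nat.le_induction with
  | base => exact le_rfl
  | succ r _ ih =>
    have hstep : 4 * ∑ i ∈ range (r + 1), (t + 2 * r + 1).choose i ≤
        ∑ i ∈ range (r + 1 + 1), (t + 2 * (r + 1) + 1).choose i := by
      have hmono : (t + 2 * r + 1).choose r ≤ (t + 2 * r + 1).choose (r + 1) :=
        Nat.choose_le_succ_of_lt_half_left (by omega)
      rw [show t + 2 * (r + 1) + 1 = t + 2 * r + 1 + 1 + 1 by ring,
        sum_range_choose_succ (t + 2 * r + 1 + 1), sum_range_choose_succ (t + 2 * r + 1),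
        sum_range_choose_succ (t + 2 * r + 1),
        Finset.sum_range_succ _ (r + 1), Finset.sum_range_succ _ r]
      omega
    calc _ = 4 * (2 ^ (t + 2 * r + 1) * ∑ i ∈ range (k + 1), (t + 2 * k + 1).choose i) := by
          ring
      _ ≤ 4 * (2 ^ (t + 2 * k + 1) * ∑ i ∈ range (r + 1), (t + 2 * r + 1).choose i) := by gcongr
      _ = 2 ^ (t + 2 * k + 1) * (4 * ∑ i ∈ range (r + 1), (t + 2 * r + 1).choose i) := by ring
      _ ≤ _ := by gcongr

theorem card_filter_card_inter_le {n : ℕ} (T : Finset (Fin n)) (r : ℕ) :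
    2 ^ n * ∑ i ∈ range (r + 1), (#T).choose i ≤
      2 ^ #T * #{P : Finset (Fin n) | #(P ∩ T) ≤ r} := by
  have hball : #{A ∈ T.powerset | #A ≤ r} = ∑ i ∈ range (r + 1), (#T).choose i := by
    rw [Finset.card_eq_sum_card_fiberwise (f := Finset.card) (t := range (r + 1))]
    · refine Finset.sum_congr rfl fun i hi => ?_
      rw [← Finset.card_powersetCard]
      congr 1
      ext A
      simp only [mem_filter, mem_powerset, mem_powersetCard, mem_range] at hi ⊢
      constructor
      · rintro ⟨⟨hA, -⟩, hi⟩
        exact ⟨hA, hi⟩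
      · rintro ⟨hA, rfl⟩
        exact ⟨⟨hA, by omega⟩, rfl⟩
    · intro A hA
      simp only [coe_filter, mem_powerset, Set.mem_ofPred_eq, coe_range, Set.mem_Iio] at hA ⊢
      omega
  have hprod : #({A ∈ T.powerset | #A ≤ r} ×ˢ Tᶜ.powerset) ≤
      #{P : Finset (Fin n) | #(P ∩ T) ≤ r} := by
    have hT : ∀ A B : Finset (Fin n), A ⊆ T → B ⊆ Tᶜ → (A ∪ B) ∩ T = A := by
      intro A B hA hB
      ext k
      have := @hA k
      have := @hB k
      simp only [mem_compl, mem_inter, mem_union] at *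
      tauto
    have hTc : ∀ A B : Finset (Fin n), A ⊆ T → B ⊆ Tᶜ → (A ∪ B) \ T = B := by
      intro A B hA hB
      ext k
      have := @hA k
      have := @hB k
      simp only [mem_compl, mem_sdiff, mem_union] at *
      tauto
    refine Finset.card_le_card_of_injOn (fun z => z.1 ∪ z.2) ?_ ?_
    · rintro ⟨A, B⟩ h
      simp only [coe_product, coe_filter, mem_powerset, Set.mem_prod, Set.mem_ofPred_eq,
        mem_coe] at h
      simpa [hT A B h.1.1 h.2] using h.1.2
    · rintro ⟨A, B⟩ h ⟨A', B'⟩ h' heq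
      simp only [coe_product, coe_filter, mem_powerset, Set.mem_prod, Set.mem_ofPred_eq,
        mem_coe] at h h' heq
      have hA := hT A B h.1.1 h.2
      have hB := hTc A B h.1.1 h.2
      rw [heq] at hA hB
      rw [← hA, ← hB, hT A' B' h'.1.1 h'.2, hTc A' B' h'.1.1 h'.2]
  rw [Finset.card_product, hball, Finset.card_powerset, Finset.card_compl,
    Fintype.card_fin] at hprod
  have hTn : #T ≤ n := by simpa using Finset.card_le_univ T
  calc _ = 2 ^ #T * ((∑ i ∈ range (r + 1), (#T).choose i) * 2 ^ (n - #T)) := by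
        rw [mul_left_comm, ← pow_add, Nat.add_sub_cancel' hTn, mul_comm]
    _ ≤ _ := by gcongr

/-- The sets meeting `D` in at most half of `#D - t` points; those attaining the bound are required
to contain the least element of `D`. -/
def flipSets {n : ℕ} (t : ℕ) (D : Finset (Fin n)) : Finset (Finset (Fin n)) :=
  {P | 2 * #(P ∩ D) + t ≤ #D ∧ (2 * #(P ∩ D) + t = #D → ∃ e ∈ P ∩ D, ∀ k ∈ D, e ≤ k)}

theorem card_flipSets_ge {n t k : ℕ} (ht : 1 ≤ t) (D : Finset (Fin n))
    (hD : t + (2 * k + 1) ≤ #D) :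
    2 ^ n * ∑ i ∈ range (k + 1), (t + 2 * k + 1).choose i ≤
      2 ^ (t + 2 * k + 1) * #(flipSets t D) := by
  obtain ⟨r, T, hkr, hT, hsub⟩ : ∃ (r : ℕ) (T : Finset (Fin n)), k ≤ r ∧ #T = t + 2 * r + 1 ∧
      ({P : Finset (Fin n) | #(P ∩ T) ≤ r} : Finset _) ⊆ flipSets t D := by
    obtain ⟨u, hu⟩ := Nat.exists_eq_add_of_le hD
    rcases Nat.even_or_odd' u with ⟨c, rfl | rfl⟩
    · refine ⟨k + c, D, by omega, by omega, fun P hP => ?_⟩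
      simp only [flipSets, mem_filter, mem_univ, true_and] at hP ⊢
      exact ⟨by omega, fun h => by omega⟩
    · have hne : D.Nonempty := Finset.card_pos.1 (by omega)
      have hmem := D.min'_mem hne
      refine ⟨k + c, D.erase (D.min' hne), by omega, ?_, fun P hP => ?_⟩
      · rw [Finset.card_erase_of_mem hmem]
        omega
      · simp only [flipSets, mem_filter, mem_univ, true_and] at hP ⊢
        rw [Finset.inter_erase] at hP
        have hle := Finset.pred_card_le_card_erase (s := P ∩ D) (a := D.min' hne)
        refine ⟨by omega, fun h => ⟨D.min' hne, ?_, fun k hk => D.min'_le k hk⟩⟩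
        by_contra hnot
        rw [Finset.erase_eq_of_notMem hnot] at hP
        omega
  have h₁ := card_filter_card_inter_le T r
  rw [hT] at h₁
  have h₂ := ball_density_mono ht hkr
  have h₃ := Finset.card_le_card hsub
  refine Nat.le_of_mul_le_mul_left ?_ (pow_pos two_pos (t + 2 * r + 1))
  calc _ = 2 ^ n * (2 ^ (t + 2 * r + 1) * ∑ i ∈ range (k + 1), (t + 2 * k + 1).choose i) := by
        ring
    _ ≤ 2 ^ n * (2 ^ (t + 2 * k + 1) * ∑ i ∈ range (r + 1), (t + 2 * r + 1).choose i) := by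
        gcongr
    _ = 2 ^ (t + 2 * k + 1) * (2 ^ n * ∑ i ∈ range (r + 1), (t + 2 * r + 1).choose i) := by ring
    _ ≤ 2 ^ (t + 2 * k + 1) * (2 ^ (t + 2 * r + 1) * #(flipSets t D)) := by
        exact Nat.mul_le_mul_left _ (h₁.trans (Nat.mul_le_mul_left _ h₃))
    _ = _ := by ring

section Words

variable {n : ℕ} {X : Type*} [DecidableEq X]

/-- The coordinates where two words differ. -/
def diffSet (a b : Fin n → X) : Finset (Fin n) := {k | a k ≠ b k}

/-- The word `a`, with the entries in `P` replaced by those of `b` where `a` and `b` differ and by a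
new symbol where they agree. -/
def rowWord (a b : Fin n → X) (P : Finset (Fin n)) (k : Fin n) : Option X :=
  if k ∈ P then (if a k = b k then none else some (b k)) else some (a k)

/-- The word that differs from `rowWord a b P` everywhere and uses only `a`, `b` and the new
symbol. -/
def colWord (a b : Fin n → X) (P : Finset (Fin n)) (k : Fin n) : Option X :=
  if a k = b k then (if k ∈ P then some (b k) else none)
  else (if k ∈ P then some (a k) else some (b k))

/-- The coordinates where `colWord a b P` departs from `b`. -/
def colSet (a b : Fin n → X) (P : Finset (Fin n)) : Finset (Fin n) :=
  {k | (k ∈ P ↔ a k ≠ b k)}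

/-- Breaks ties between the pairs of words whose sets have equal size. -/
def tieRank (t : ℕ) (a b : Fin n → X) (P : Finset (Fin n)) (k : Fin n) : ℕ :=
  if 2 * #(P ∩ diffSet a b) + t = #(diffSet a b) then
    (if a k ≠ b k then 1 else if k ∈ P then 2 else 0)
  else 0

theorem rowWord_ne_colWord (a b : Fin n → X) (P : Finset (Fin n)) (k : Fin n) :
    rowWord a b P k ≠ colWord a b P k := by
  unfold rowWord colWord
  split_ifs <;> simp_all [eq_comm]

theorem eq_of_forall_rowWord_ne_colWord (a b : Fin n → X) (P P' : Finset (Fin n))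
    (h : ∀ k, rowWord a b P k ≠ colWord a b P' k) : P = P' := by
  ext k
  have hk := h k
  unfold rowWord colWord at hk
  by_cases h₁ : k ∈ P <;> by_cases h₂ : k ∈ P' <;> by_cases h₃ : a k = b k <;> simp_all

theorem card_colSet (a b : Fin n → X) (P : Finset (Fin n)) :
    #(colSet a b P) + #P + #(diffSet a b) = n + 2 * #(P ∩ diffSet a b) := by
  have h₁ : colSet a b P = (P ∪ diffSet a b)ᶜ ∪ (P ∩ diffSet a b) := by
    ext k
    simp only [colSet, diffSet, mem_filter, mem_univ, true_and, mem_union, mem_compl, mem_inter]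
    tauto
  have h₂ : Disjoint (P ∪ diffSet a b)ᶜ (P ∩ diffSet a b) := by
    rw [Finset.disjoint_left]
    intro k
    simp only [mem_union, mem_compl, mem_inter]
    tauto
  have h₃ := Finset.card_union_add_card_inter P (diffSet a b)
  have h₄ := Finset.card_add_card_compl (P ∪ diffSet a b)
  rw [Fintype.card_fin] at h₄
  rw [h₁, Finset.card_union_of_disjoint h₂]
  omega

/-- If `P` avoids `colSet a' b' P'`, which contains the least element of `diffSet a' b'`, then the
tie-breaking rank increases. -/
theorem tieRank_lt {t : ℕ} {a b a' b' : Fin n → X} {P P' : Finset (Fin n)}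
    (hP : P ∈ flipSets t (diffSet a b)) (hP' : P' ∈ flipSets t (diffSet a' b'))
    (htight : 2 * #(P' ∩ diffSet a' b') + t = #(diffSet a' b'))
    (hdisj : Disjoint P (colSet a' b' P')) :
    toLex (tieRank t a b P) < toLex (tieRank t a' b' P') := by
  simp only [flipSets, mem_filter, mem_univ, true_and] at hP hP'
  obtain ⟨e', he', hmin'⟩ := hP'.2 htight
  have hdis : ∀ k, k ∈ P → ¬ (k ∈ P' ↔ a' k ≠ b' k) := by
    intro k hk hk'
    exact Finset.disjoint_left.1 hdisj hk (by simpa [colSet] using hk')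
  simp only [mem_inter, diffSet, mem_filter, mem_univ, true_and] at he' hmin'
  by_cases hb : 2 * #(P ∩ diffSet a b) + t = #(diffSet a b)
  · obtain ⟨e, he, hmin⟩ := hP.2 hb
    simp only [mem_inter, diffSet, mem_filter, mem_univ, true_and] at he hmin
    have hbelow : ∀ k, k < min e e' → tieRank t a b P k ≤ tieRank t a' b' P' k := by
      intro k hk
      have h₁ : a k = b k := by
        by_contra h
        exact absurd (hmin k h) (not_le.2 (lt_of_lt_of_le hk (min_le_left _ _)))
      have h₂ : a' k = b' k := by
        by_contra h
        exact absurd (hmin' k h) (not_le.2 (lt_of_lt_of_le hk (min_le_right _ _)))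
      have := hdis k
      simp only [tieRank, hb, htight, if_true, h₁, h₂]
      by_cases hkP : k ∈ P <;> by_cases hkP' : k ∈ P' <;> simp_all
    have hat : tieRank t a b P (min e e') < tieRank t a' b' P' (min e e') := by
      have hne : e ≠ e' := by
        rintro rfl
        exact hdis e he.1 ⟨fun _ => he'.2, fun _ => he'.1⟩
      rcases lt_or_gt_of_ne hne with hlt | hlt
      · rw [min_eq_left hlt.le]
        have h₂ : a' e = b' e := by
          by_contra h
          exact absurd (hmin' e h) (not_le.2 hlt)
        have := hdis e he.1
        simp only [tieRank, hb, htight, if_true]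
        simp_all
      · rw [min_eq_right hlt.le]
        have h₁ : a e' = b e' := by
          by_contra h
          exact absurd (hmin e' h) (not_le.2 hlt)
        have : e' ∉ P := fun h => hdis e' h ⟨fun _ => he'.2, fun _ => he'.1⟩
        simp only [tieRank, hb, htight, if_true]
        simp_all
    by_contra hnot
    rcases (not_lt.1 hnot).lt_or_eq with hlt | heq
    · obtain ⟨k, hk, hlt⟩ := hlt
      rcases lt_trichotomy k (min e e') with h | h | h
      · exact absurd (hbelow k h) (not_le.2 hlt)
      · exact absurd hat (not_lt.2 (h ▸ hlt.le))
      · exact absurd (hk _ h) hat.ne'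
    · exact hat.ne' (congrFun (toLex.injective heq) _)
  · refine Pi.toLex_strictMono (Pi.lt_def.2 ⟨fun k => ?_, e', ?_⟩)
    · simp [tieRank, hb]
    · simp [tieRank, hb, htight, he'.2]

end Words

/-- The set-pair bound in the case of an odd gap `2 k + 1`. -/
theorem card_mul_ball_le {n t k m : ℕ} {X : Type*} [DecidableEq X] (ht : 1 ≤ t)
    (a b : Fin m → (Fin n → X))
    (h1 : ∀ i, t + (2 * k + 1) ≤ hammingDist (a i) (b i))
    (h2 : ∀ i j, i ≠ j → hammingDist (a i) (b j) ≤ t) :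
    m * ∑ i ∈ range (k + 1), (t + 2 * k + 1).choose i ≤ 2 ^ (t + 2 * k + 1) := by
  let F : Fin m → Finset (Finset (Fin n)) := fun i => flipSets t (diffSet (a i) (b i))
  let R := Σ i, F i
  have hcard : Fintype.card R ≤ 2 ^ n := by
    refine card_le_two_pow_of_skew_words
      (fun r : R => rowWord (a r.1) (b r.1) r.2) (fun r : R => colWord (a r.1) (b r.1) r.2)
      (fun r : R => toLex
        (OrderDual.toDual #r.2.1, toLex (tieRank t (a r.1) (b r.1) r.2)))
      (fun r => rowWord_ne_colWord _ _ _) ?_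
    rintro ⟨i, P, hP⟩ ⟨j, P', hP'⟩ hne h
    dsimp only at h ⊢
    have hij : i ≠ j := by
      rintro rfl
      exact hne (by simp [eq_of_forall_rowWord_ne_colWord _ _ _ _ h])
    have hcover : (diffSet (a i) (b j))ᶜ ⊆ P ∪ colSet (a j) (b j) P' := by
      intro k hk
      by_contra hnot
      have hk' := h k
      simp only [diffSet, colSet, mem_compl, mem_filter, mem_univ, true_and, not_not,
        mem_union, not_or] at hk hnot
      simp only [rowWord, colWord, hnot.1, if_false] at hk'
      split_ifs at hk' <;> simp_all
    have hd : #(diffSet (a i) (b j)) ≤ t := h2 i j hij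
    have hcompl := Finset.card_add_card_compl (diffSet (a i) (b j))
    rw [Fintype.card_fin] at hcompl
    have hle := Finset.card_le_card hcover
    have hui := Finset.card_union_add_card_inter P (colSet (a j) (b j) P')
    have hcol := card_colSet (a j) (b j) P'
    have hflip := hP'
    simp only [F, flipSets, mem_filter, mem_univ, true_and] at hflip
    rw [Prod.Lex.toLex_lt_toLex]
    by_cases hlt : #P' < #P
    · exact Or.inl hlt
    · refine Or.inr ⟨congrArg OrderDual.toDual (by omega), tieRank_lt hP hP' (by omega) ?_⟩
      rw [Finset.disjoint_iff_inter_eq_empty, ← Finset.card_eq_zero]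
      omega
  have hsum : Fintype.card R = ∑ i, #(F i) := by simp [R]
  have hF : ∀ i, 2 ^ n * ∑ i ∈ range (k + 1), (t + 2 * k + 1).choose i ≤
      2 ^ (t + 2 * k + 1) * #(F i) := fun i => card_flipSets_ge ht _ (h1 i)
  refine Nat.le_of_mul_le_mul_left ?_ (pow_pos two_pos n)
  calc _ = ∑ _i : Fin m, 2 ^ n * ∑ i ∈ range (k + 1), (t + 2 * k + 1).choose i := by
        simp [mul_left_comm]
    _ ≤ ∑ i, 2 ^ (t + 2 * k + 1) * #(F i) := Finset.sum_le_sum fun i _ => hF i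
    _ = 2 ^ (t + 2 * k + 1) * Fintype.card R := by rw [hsum, Finset.mul_sum]
    _ ≤ 2 ^ (t + 2 * k + 1) * 2 ^ n := by gcongr
    _ = _ := mul_comm _ _

theorem V_odd (N k : ℕ) : V N (2 * k + 1) = ∑ i ∈ range (k + 1), N.choose i := by
  simp [V, Nat.add_mod]

theorem V_even (N k : ℕ) : V (N + 1) (2 * k + 2) = 2 * ∑ i ∈ range (k + 1), N.choose i := by
  have h : (2 * k + 2) / 2 = k + 1 := by omega
  simp only [V, h]
  rw [if_neg (by omega), sum_range_choose_succ, Nat.add_sub_cancel, Nat.add_sub_cancel,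
    Finset.sum_range_succ]
  ring

theorem sum_range_choose_pos (N k : ℕ) : 0 < ∑ i ∈ range (k + 1), N.choose i :=
  Finset.sum_pos' (fun _ _ => Nat.zero_le _) ⟨0, by simp⟩

theorem stmt_4 (n t s : ℕ) (hs : 1 ≤ s) (hts : s ≤ t) (ht : t < n)
    (X : Type*) [DecidableEq X] [Nonempty X]
    (m : ℕ) (a b : Fin m → (Fin n → X))
    (h1 : ∀ i, t + s ≤ hammingDist (a i) (b i))
    (h2 : ∀ i j, i ≠ j → hammingDist (a i) (b j) ≤ t) :
    (m : ℝ) ≤ 2 ^ (t + s) / V (t + s) s := by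
  suffices h : 0 < V (t + s) s ∧ m * V (t + s) s ≤ 2 ^ (t + s) by
    rw [le_div_iff₀ (by exact_mod_cast h.1)]
    exact_mod_cast h.2
  obtain ⟨k, rfl | rfl⟩ : ∃ k, s = 2 * k + 1 ∨ s = 2 * k + 2 := ⟨(s - 1) / 2, by omega⟩
  · rw [V_odd]
    exact ⟨sum_range_choose_pos _ _, card_mul_ball_le (by omega) a b h1 h2⟩
  · have h := card_mul_ball_le (k := k) (by omega) a b (fun i => by have := h1 i; omega) h2
    rw [show t + (2 * k + 2) = t + 2 * k + 1 + 1 by ring, V_even]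
    refine ⟨Nat.mul_pos two_pos (sum_range_choose_pos _ _), ?_⟩
    rw [pow_succ, mul_left_comm, mul_comm]
    gcongr
end

section
/- Let n > t ≥ 0 and suppose a_1,…,a_m, b_1,…,b_m ∈ X^n, where X is any nonempty set, satisfy dist(a_i,b_i) = t + s_i for some integers s_i ≥ 1 for all i ∈ [m], and dist(a_i,b_j) ≤ t for all distinct i,j ∈ [m]. Then sum over i of V_{t+s_i, s_i} / 2^{t+s_i} is at most 1, where V_{N,d} = sum_{i=0}^{(d-1)/2} C(N,i) if d is odd and V_{N,d} = sum_{i=0}^{d/2−1} C(N,i) + C(N−1, d/2−1) if d is even. -/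
open Finset

namespace HammingPairs

/-- If the pairings of two families of vectors form a triangular matrix with nonzero diagonal,
then the families are no larger than the dimension of the ambient space. -/
lemma card_le_card_of_triangular {ι κ F O : Type*} [Field F] [Fintype ι] [Fintype κ]
    [LinearOrder O] (R C : ι → κ → F) (key : ι → O) (hdiag : ∀ e, R e ⬝ᵥ C e ≠ 0)
    (htri : ∀ e e', e ≠ e' → R e ⬝ᵥ C e' ≠ 0 → key e' < key e) :
    Fintype.card ι ≤ Fintype.card κ := by
  classical
  have hli : LinearIndependent F R := by
    rw [Fintype.linearIndependent_iff]
    intro c hc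
    by_contra! hne
    obtain ⟨e₁, he₁⟩ := hne
    obtain ⟨e₀, he₀, hmax⟩ := (univ.filter fun e => c e ≠ 0).exists_max_image key
      ⟨e₁, by simpa using he₁⟩
    have hsum : ∑ e, c e * (R e ⬝ᵥ C e₀) = 0 := by
      have := congrArg (· ⬝ᵥ C e₀) hc
      simpa [sum_dotProduct] using this
    rw [sum_eq_single e₀] at hsum
    · exact (mul_ne_zero (by simpa using he₀) (hdiag e₀)) hsum
    · intro e _ hee
      by_contra hprod
      obtain ⟨hce, hRC⟩ := mul_ne_zero_iff.mp hprod
      exact absurd (htri e e₀ hee hRC) (hmax e (by simpa using hce)).not_gt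
    · simp
  simpa using hli.fintype_card_le_finrank

/-- The coordinates of a pure tensor of vectors of the plane. -/
def tensor {n : ℕ} (u : Fin n → ℚ × ℚ) (T : Finset (Fin n)) : ℚ :=
  (∏ k ∈ T, (u k).1) * ∏ k ∈ univ \ T, (u k).2

/-- The quarter turn, which turns the dot product of the plane into the determinant. -/
def turn (v : ℚ × ℚ) : ℚ × ℚ := (v.2, -v.1)

lemma tensor_dotProduct {n : ℕ} (u v : Fin n → ℚ × ℚ) :
    tensor u ⬝ᵥ tensor v = ∏ k, ((u k).1 * (v k).1 + (u k).2 * (v k).2) := by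
  rw [prod_add, powerset_univ]
  refine sum_congr rfl fun T _ => ?_
  simp only [tensor, prod_mul_distrib]
  ring

/-- The vector attached to one coordinate of a pair `(c, d)`: it represents `c` when `z` fails,
and when `z` holds it represents `d`, or the point at infinity in case `d = c`. -/
def vec (c d : ℚ) (z : Prop) [Decidable z] : ℚ × ℚ :=
  if z then (if c = d then (0, 1) else (1, d)) else (1, c)

/-- The pairing of the vectors attached to one coordinate. -/
def pairing (c d : ℚ) (z : Prop) [Decidable z] (c' d' : ℚ) (z' : Prop) [Decidable z'] : ℚ :=
  (vec c d z).1 * (turn (vec c' d' ¬z')).1 + (vec c d z).2 * (turn (vec c' d' ¬z')).2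

lemma pairing_self_ne_zero_iff (c d : ℚ) (z z' : Prop) [Decidable z] [Decidable z'] :
    pairing c d z c d z' ≠ 0 ↔ (z ↔ z') := by
  have h (h : c ≠ d) : d ≠ c := h.symm
  by_cases hz : z <;> by_cases hz' : z' <;> by_cases hcd : c = d <;>
    simp [pairing, vec, turn, hz, hz', hcd, ← sub_eq_add_neg, sub_eq_zero]
  exact h hcd

/-- A nonvanishing pairing forces a change somewhere on the way from the first vector through
`c` and `d'` to the second one. -/
lemma one_le_of_pairing_ne_zero {c d c' d' : ℚ} {z z' : Prop} [Decidable z] [Decidable z']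
    (h : pairing c d z c' d' z' ≠ 0) :
    1 ≤ (if z then 1 else 0) + (if c ≠ d' then 1 else 0) +
      (if (c' ≠ d' ↔ z') then 1 else 0) := by
  contrapose! h
  by_cases hz : z <;> by_cases hz' : z' <;> by_cases hcd : c = d' <;> by_cases hcd' : c' = d' <;>
    simp_all [pairing, vec, turn]

/-- The sets of coordinates in which a pair differing exactly on `D` gets modified. -/
def Admissible {n : ℕ} (D : Finset (Fin n)) (s : ℕ) (z : Finset (Fin n)) : Prop :=
  2 * #(z ∩ D) < s ∨ 2 * #(z ∩ D) = s ∧ ∃ p ∈ z ∩ D, ∀ k ∈ D, k ≤ p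

lemma sum_ite_mem_iff {n : ℕ} (D z : Finset (Fin n)) :
    (∑ k, if (k ∈ D ↔ k ∈ z) then 1 else 0) + #D + #z = n + 2 * #(z ∩ D) := by
  have hD : #D = ∑ k, if k ∈ D then 1 else 0 := by simp
  have hz : #z = ∑ k, if k ∈ z then 1 else 0 := by simp
  have hzD : n + 2 * #(z ∩ D) = ∑ k, (1 + 2 * if k ∈ z ∩ D then 1 else 0) := by
    rw [sum_add_distrib, ← mul_sum, sum_boole, filter_mem_eq_inter, univ_inter]
    simp
  rw [hD, hz, hzD, ← sum_add_distrib, ← sum_add_distrib]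
  refine sum_congr rfl fun k _ => ?_
  by_cases h₁ : k ∈ D <;> by_cases h₂ : k ∈ z <;> simp [h₁, h₂]

/-- Modifications are compared by size, and those of the same size in reverse colexicographic
order. -/
def key {n : ℕ} (z : Finset (Fin n)) : ℕ ×ₗ (Colex (Finset (Fin n)))ᵒᵈ :=
  toLex (#z, OrderDual.toDual (toColex z))

lemma key_lt_key {n t s : ℕ} {a b a' b' : Fin n → ℚ} {z z' : Finset (Fin n)}
    (hs : #{k | a' k ≠ b' k} = t + s) (ht : #{k | a k ≠ b' k} ≤ t)
    (hz' : Admissible {k | a' k ≠ b' k} s z')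
    (h : ∀ k, pairing (a k) (b k) (k ∈ z) (a' k) (b' k) (k ∈ z') ≠ 0) :
    key z' < key z := by
  set D : Finset (Fin n) := {k | a' k ≠ b' k} with hD
  set f : Fin n → ℕ := fun k => (if k ∈ z then 1 else 0) + (if a k ≠ b' k then 1 else 0) +
      (if (k ∈ D ↔ k ∈ z') then 1 else 0) with hf
  have hone k : 1 ≤ f k := by
    have := one_le_of_pairing_ne_zero (h k)
    simpa only [hf, hD, mem_filter, mem_univ, true_and] using this
  have hn : ∑ _k : Fin n, 1 = n := by simp
  have hle : ∑ _k : Fin n, 1 ≤ ∑ k, f k := sum_le_sum fun k _ => hone k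
  have hsum : ∑ k, f k = #z + #{k | a k ≠ b' k} + ∑ k, if (k ∈ D ↔ k ∈ z') then 1 else 0 := by
    simp only [hf, sum_add_distrib, card_filter]
    simp
  have hcount := sum_ite_mem_iff D z'
  rw [key, key, Prod.Lex.toLex_lt_toLex]
  rcases hz' with hlt | ⟨heq, p, hp, hmax⟩
  · left
    dsimp only
    omega
  · rcases lt_or_ge #z' #z with hlt | hge
    · exact Or.inl hlt
    · right
      have hall : ∀ k ∈ univ, 1 = f k :=
        (sum_eq_sum_iff_of_le fun k _ => hone k).mp (by omega)
      refine ⟨by dsimp only; omega, ?_⟩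
      rw [OrderDual.toDual_lt_toDual]
      obtain ⟨hpz', hpD⟩ := mem_inter.mp hp
      have hpz : p ∉ z := by
        intro hpz
        have := hall p (mem_univ p)
        simp only [hf, hpz, hpz', hpD] at this
        simp at this
      refine lt_of_le_of_ne (Colex.toColex_le_toColex.mpr fun k hk hkz' => ?_) ?_
      · refine ⟨p, hpz', hpz, ?_⟩
        by_contra! hpk
        have hkD : k ∉ D := fun hkD => (hmax k hkD).not_gt hpk
        have := hall k (mem_univ k)
        simp only [hf, hk, hkz', hkD] at this
        simp at this
      · intro heq'
        rw [toColex_inj] at heq'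
        exact hpz (heq' ▸ hpz')

/-- The number of small subsets of `D`. -/
lemma card_filter_card_lt {α : Type*} [DecidableEq α] (D : Finset α) (r : ℕ) :
    #{A ∈ D.powerset | #A < r} = ∑ i ∈ range r, (#D).choose i := by
  rw [card_eq_sum_card_fiberwise (f := card) (t := range r)]
  · refine sum_congr rfl fun i hi => ?_
    rw [← card_powersetCard]
    congr 1
    ext A
    simp only [mem_filter, mem_powerset, mem_powersetCard, mem_range] at *
    grind
  · intro A hA
    simpa using (mem_filter.mp hA).2

lemma V_le_card_filter {n : ℕ} (D : Finset (Fin n)) {s : ℕ} (hs : 1 ≤ s) (hD : s ≤ #D)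
    [DecidablePred (Admissible D s)] :
    V #D s ≤ #{A ∈ D.powerset | Admissible D s A} := by
  unfold V
  split_ifs with hodd
  · rw [← card_filter_card_lt]
    refine card_le_card fun A hA => ?_
    simp only [mem_filter, mem_powerset] at hA ⊢
    refine ⟨hA.1, Or.inl ?_⟩
    rw [inter_eq_left.mpr hA.1]
    omega
  · have hne : D.Nonempty := card_pos.mp (by omega)
    set p := D.max' hne
    have hp : p ∈ D := D.max'_mem hne
    have herase : #D - 1 = #(D.erase p) := (card_erase_of_mem hp).symm
    have hinj : Set.InjOn (insert p)
        (powersetCard (s / 2 - 1) (D.erase p) : Set (Finset (Fin n))) := by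
      intro A hA B hB hAB
      have hpA : p ∉ A := fun h => by simpa using (mem_powersetCard.mp hA).1 h
      have hpB : p ∉ B := fun h => by simpa using (mem_powersetCard.mp hB).1 h
      rw [← erase_insert hpA, hAB, erase_insert hpB]
    rw [← card_filter_card_lt, herase, ← card_powersetCard, ← card_image_of_injOn hinj,
      ← card_union_of_disjoint]
    · refine card_le_card fun A hA => ?_
      simp only [mem_union, mem_filter, mem_powerset, mem_image, mem_powersetCard] at hA ⊢
      rcases hA with hA | ⟨B, ⟨hBD, hB⟩, rfl⟩
      · refine ⟨hA.1, Or.inl ?_⟩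
        rw [inter_eq_left.mpr hA.1]
        omega
      · have hpB : p ∉ B := fun h => by simpa using hBD h
        have hsub : insert p B ⊆ D := insert_subset hp (hBD.trans (erase_subset _ _))
        refine ⟨hsub, Or.inr ?_⟩
        rw [inter_eq_left.mpr hsub, card_insert_of_notMem hpB]
        exact ⟨by omega, p, mem_insert_self _ _, fun k hk => D.le_max' k hk⟩
    · rw [disjoint_left]
      intro A hA hA'
      simp only [mem_filter, mem_powerset, mem_image, mem_powersetCard] at hA hA'
      obtain ⟨B, ⟨hBD, hB⟩, rfl⟩ := hA'
      have hpB : p ∉ B := fun h => by simpa using hBD h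
      have := hA.2
      rw [card_insert_of_notMem hpB] at this
      omega

lemma V_mul_two_pow_le {n : ℕ} (D : Finset (Fin n)) {s : ℕ} (hs : 1 ≤ s) (hD : s ≤ #D)
    [DecidablePred (Admissible D s)] :
    V #D s * 2 ^ n ≤ #{z | Admissible D s z} * 2 ^ #D := by
  have hcard : #{A ∈ D.powerset | Admissible D s A} * 2 ^ #Dᶜ ≤ #{z | Admissible D s z} := by
    rw [← card_powerset, ← card_product]
    refine card_le_card_of_injOn (fun q => q.1 ∪ q.2) ?_ ?_
    · rintro ⟨A, B⟩ hq
      simp only [coe_product, Set.mem_prod, mem_coe, mem_filter, mem_powerset] at hq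
      obtain ⟨⟨hA, hAs⟩, hB⟩ := hq
      have : (A ∪ B) ∩ D = A ∩ D := by
        ext k
        have := @hB k
        simp only [mem_compl, mem_inter, mem_union] at *
        tauto
      rw [mem_coe, mem_filter]
      exact ⟨mem_univ _, by simpa only [Admissible, this] using hAs⟩
    · rintro ⟨A, B⟩ hq ⟨A', B'⟩ hq' heq
      simp only [coe_product, Set.mem_prod, mem_coe, mem_filter, mem_powerset] at hq hq' heq
      have hmem (k : Fin n) : (k ∈ A ↔ k ∈ A') ∧ (k ∈ B ↔ k ∈ B') := by
        have h₁ := @hq.1.1 k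
        have h₂ := @hq.2 k
        have h₃ := @hq'.1.1 k
        have h₄ := @hq'.2 k
        have h₅ : k ∈ A ∪ B ↔ k ∈ A' ∪ B' := by rw [heq]
        simp only [mem_compl, mem_union] at *
        tauto
      exact Prod.ext (Finset.ext fun k => (hmem k).1) (Finset.ext fun k => (hmem k).2)
  have hpow : 2 ^ n = 2 ^ #Dᶜ * 2 ^ #D := by
    rw [← pow_add, card_compl_add_card, Fintype.card_fin]
  rw [hpow, ← mul_assoc]
  exact Nat.mul_le_mul_right _
    ((Nat.mul_le_mul_right _ (V_le_card_filter D hs hD)).trans hcard)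

open Classical in
lemma sum_card_admissible_le {n t m : ℕ} (a b : Fin m → Fin n → ℚ) (s : Fin m → ℕ)
    (h1 : ∀ i, hammingDist (a i) (b i) = t + s i)
    (h2 : ∀ i j, i ≠ j → hammingDist (a i) (b j) ≤ t) :
    ∑ i, #{z | Admissible {k | a i k ≠ b i k} (s i) z} ≤ 2 ^ n := by
  let ι := Σ i : Fin m, {z : Finset (Fin n) // Admissible {k | a i k ≠ b i k} (s i) z}
  let R : ι → Finset (Fin n) → ℚ := fun e =>
    tensor fun k => vec (a e.1 k) (b e.1 k) (k ∈ e.2.1)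
  let C : ι → Finset (Fin n) → ℚ := fun e =>
    tensor fun k => turn (vec (a e.1 k) (b e.1 k) ¬(k ∈ e.2.1))
  have hRC (e e' : ι) : R e ⬝ᵥ C e' =
      ∏ k, pairing (a e.1 k) (b e.1 k) (k ∈ e.2.1) (a e'.1 k) (b e'.1 k) (k ∈ e'.2.1) :=
    tensor_dotProduct _ _
  have hcard := card_le_card_of_triangular R C (fun e => key e.2.1) ?_ ?_
  · simpa [ι, Fintype.card_subtype] using hcard
  · intro e
    rw [hRC, prod_ne_zero_iff]
    intro k _
    rw [pairing_self_ne_zero_iff]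
  · rintro ⟨i, z, hz⟩ ⟨j, z', hz'⟩ hne hprod
    rw [hRC, prod_ne_zero_iff] at hprod
    have hprod k := hprod k (mem_univ k)
    rcases eq_or_ne i j with rfl | hij
    · refine absurd ?_ hne
      have : z = z' := Finset.ext fun k => (pairing_self_ne_zero_iff _ _ _ _).mp (hprod k)
      subst this
      rfl
    · exact key_lt_key (h1 j) (h2 i j hij) hz' hprod

end HammingPairs

open HammingPairs in
theorem stmt_5 (n t : ℕ) (ht : t < n) (X : Type*) [DecidableEq X] [Nonempty X]
    (m : ℕ) (a b : Fin m → (Fin n → X)) (s : Fin m → ℕ)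
    (hs : ∀ i, 1 ≤ s i)
    (h1 : ∀ i, hammingDist (a i) (b i) = t + s i)
    (h2 : ∀ i j, i ≠ j → hammingDist (a i) (b j) ≤ t) :
    ∑ i, (V (t + s i) (s i) : ℝ) / 2 ^ (t + s i) ≤ 1 := by
  classical
  have hcountable : (⋃ i, Set.range (a i) ∪ Set.range (b i)).Countable :=
    Set.countable_iUnion fun i => (Set.countable_range _).union (Set.countable_range _)
  obtain ⟨f, hf⟩ := Set.countable_iff_exists_injOn.mp hcountable
  have hdist (i j : Fin m) :
      hammingDist (fun k => (f (a i k) : ℚ)) (fun k => (f (b j k) : ℚ)) =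
        hammingDist (a i) (b j) := by
    unfold hammingDist
    congr 1
    ext k
    have ha : a i k ∈ ⋃ i, Set.range (a i) ∪ Set.range (b i) :=
      Set.mem_iUnion.mpr ⟨i, Or.inl ⟨k, rfl⟩⟩
    have hb : b j k ∈ ⋃ i, Set.range (a i) ∪ Set.range (b i) :=
      Set.mem_iUnion.mpr ⟨j, Or.inr ⟨k, rfl⟩⟩
    simp [hf.eq_iff ha hb]
  have hsum := sum_card_admissible_le (t := t) (fun i k => (f (a i k) : ℚ))
    (fun i k => (f (b i k) : ℚ)) s (fun i => (hdist i i).trans (h1 i))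
    (fun i j hij => (hdist i j).trans_le (h2 i j hij))
  have hterm (i : Fin m) : (V (t + s i) (s i) : ℝ) / 2 ^ (t + s i) ≤
      (#{z | Admissible {k | (f (a i k) : ℚ) ≠ (f (b i k) : ℚ)} (s i) z} : ℝ) / 2 ^ n := by
    rw [div_le_div_iff₀ (by positivity) (by positivity)]
    have hD : #{k | (f (a i k) : ℚ) ≠ (f (b i k) : ℚ)} = t + s i := (hdist i i).trans (h1 i)
    have := V_mul_two_pow_le {k | (f (a i k) : ℚ) ≠ (f (b i k) : ℚ)} (hs i) (by omega)
    rw [hD] at this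
    exact_mod_cast this
  refine (sum_le_sum fun i _ => hterm i).trans ?_
  rw [← sum_div, div_le_one (by positivity)]
  exact_mod_cast hsum
end

section
/- Let s > k ≥ ℓ ≥ 0 and suppose A_1,…,A_m, B_1,…,B_m are finite sets such that |A_i| + |B_i| = s for all i ∈ [m], |A_i ∩ B_i| ≤ ℓ for all i ∈ [m], and |A_i ∩ B_j| + |A_j ∩ B_i| ≥ 2(k+1) for all 1 ≤ i < j ≤ m. Then m ≤ 2^{s−2ℓ−1} / (sum_{i=0}^{k−ℓ} C(s−2ℓ−1, i)). -/
open Finset in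
/-- Enlarging the dimension by two and the radius by one multiplies the volume of a small Hamming
ball by at least four. -/
lemma four_mul_sum_choose_le (n u : ℕ) (h : 2 * u + 1 ≤ n) :
    4 * ∑ i ∈ range (u + 1), n.choose i ≤ ∑ i ∈ range (u + 2), (n + 2).choose i := by
  have hmono : n.choose u ≤ n.choose (u + 1) := by
    refine Nat.le_of_mul_le_mul_right ?_ u.succ_pos
    rw [Nat.choose_succ_right_eq]
    exact Nat.mul_le_mul_left _ (by omega)
  have pascal (N c : ℕ) : ∑ i ∈ range (c + 1), (N + 1).choose i
      = ∑ i ∈ range (c + 1), N.choose i + ∑ i ∈ range c, N.choose i := by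
    induction c with
    | zero => simp
    | succ c ih =>
      rw [sum_range_succ, ih, sum_range_succ _ (c + 1), sum_range_succ _ c, Nat.choose_succ_succ']
      ring
  rw [pascal (n + 1) (u + 1), pascal n (u + 1), pascal n u, sum_range_succ _ (u + 1),
    sum_range_succ _ u]
  omega

open Finset in
lemma two_pow_mul_sum_choose_le (n u r : ℕ) (h : 2 * u + 1 ≤ n) :
    2 ^ (2 * r) * ∑ i ∈ range (u + 1), n.choose i
      ≤ ∑ i ∈ range (u + r + 1), (n + 2 * r).choose i := by
  induction r with
  | zero => simp
  | succ r ih =>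
    calc 2 ^ (2 * (r + 1)) * ∑ i ∈ range (u + 1), n.choose i
        = 4 * (2 ^ (2 * r) * ∑ i ∈ range (u + 1), n.choose i) := by ring
      _ ≤ 4 * ∑ i ∈ range (u + r + 1), (n + 2 * r).choose i := Nat.mul_le_mul_left _ ih
      _ ≤ _ := four_mul_sum_choose_le (n + 2 * r) (u + r) (by omega)

open Finset in
lemma card_filter_powerset_card_le {α : Type*} [DecidableEq α] (S : Finset α) (c : ℕ) :
    (S.powerset.filter fun z => z.card ≤ c).card = ∑ i ∈ range (c + 1), S.card.choose i := by
  rw [card_eq_sum_card_fiberwise (f := card) (t := range (c + 1))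
    (fun z hz => by simp at hz ⊢; omega)]
  refine sum_congr rfl fun i hi => ?_
  rw [← card_powersetCard]
  congr 1
  ext z
  simp only [mem_filter, mem_powerset, mem_powersetCard, mem_range] at hi ⊢
  constructor
  · rintro ⟨⟨h, -⟩, h'⟩
    exact ⟨h, h'⟩
  · rintro ⟨h, h'⟩
    exact ⟨⟨h, by omega⟩, h'⟩

open Finset in
/-- The number of subsets of `U` whose trace on `S` lies within Hamming distance `c` of that of
`A` is at least that of the cylinder over a Hamming ball of radius `c`. -/
lemma le_card_filter_symmDiff_inter {α : Type*} [DecidableEq α] (U S A : Finset α) (hS : S ⊆ U)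
    (hA : A ⊆ U) (c : ℕ) :
    (∑ i ∈ range (c + 1), S.card.choose i) * 2 ^ (U.card - S.card)
      ≤ (U.powerset.filter fun x => (symmDiff x A ∩ S).card ≤ c).card := by
  rw [← card_filter_powerset_card_le, ← card_sdiff_of_subset hS, ← card_powerset, ← card_product]
  have trace {z w : Finset α} (hz : z ⊆ S) (hw : w ⊆ U \ S) : (z ∪ w) ∩ S = z := by
    ext a
    have := @hz a
    have := @hw a
    simp only [mem_sdiff, mem_inter, mem_union] at *
    tauto
  have cotrace {z w : Finset α} (hz : z ⊆ S) (hw : w ⊆ U \ S) : (z ∪ w) \ S = w := by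
    ext a
    have := @hz a
    have := @hw a
    simp only [mem_sdiff, mem_union] at *
    tauto
  refine card_le_card_of_injOn (fun q => symmDiff (q.1 ∪ q.2) A) ?_ ?_
  · rintro ⟨z, w⟩ hq
    simp only [coe_product, Set.mem_prod, mem_coe, mem_filter, mem_powerset] at hq ⊢
    obtain ⟨⟨hz, hc⟩, hw⟩ := hq
    refine ⟨?_, by rwa [symmDiff_symmDiff_cancel_right, trace hz hw]⟩
    exact symmDiff_le_sup.trans
      (union_subset (union_subset (hz.trans hS) (hw.trans sdiff_subset)) hA)
  · rintro ⟨z, w⟩ hq ⟨z', w'⟩ hq' h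
    simp only [coe_product, Set.mem_prod, mem_coe, mem_filter, mem_powerset] at hq hq'
    have h' : z ∪ w = z' ∪ w' := symmDiff_left_injective A h
    rw [Prod.mk.injEq]
    constructor
    · rw [← trace hq.1.1 hq.2, h', trace hq'.1.1 hq'.2]
    · rw [← cotrace hq.1.1 hq.2, h', cotrace hq'.1.1 hq'.2]

open Finset in
/-- A triangle-type inequality: the cross intersections are controlled by the self intersections
and the distances of `x` to `A` and `A'`, with one coordinate dropped from each distance. -/
lemma card_cross_inter_le {α : Type*} [DecidableEq α] (A B A' B' x : Finset α) (p p' : α)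
    (hp : p ∈ symmDiff A B) (hp' : p' ∈ symmDiff A' B')
    (h : p ∈ symmDiff A' B' → p' ∈ symmDiff A B → p = p') :
    (A ∩ B').card + (A' ∩ B).card ≤ (A ∩ B).card + (A' ∩ B').card
      + (symmDiff x A ∩ (symmDiff A B).erase p).card
      + (symmDiff x A' ∩ (symmDiff A' B').erase p').card + 1 := by
  set W := A ∪ B ∪ A' ∪ B' with hW
  have card_eq (T : Finset α) (hT : T ⊆ W) : T.card = ∑ a ∈ W, if a ∈ T then 1 else 0 := by
    rw [← card_filter, filter_mem_eq_inter, inter_eq_right.2 hT]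
  obtain ⟨q, hq⟩ : ∃ q, q = p ∧ q = p' ∨ q = p' ∧ p ∉ symmDiff A' B'
      ∨ q = p ∧ p' ∉ symmDiff A B := by
    by_cases h₁ : p ∈ symmDiff A' B'
    · by_cases h₂ : p' ∈ symmDiff A B
      · exact ⟨p, .inl ⟨rfl, h h₁ h₂⟩⟩
      · exact ⟨p, .inr (.inr ⟨rfl, h₂⟩)⟩
    · exact ⟨p', .inr (.inl ⟨rfl, h₁⟩)⟩
  have hqW : {q} ⊆ W := by
    rw [singleton_subset_iff]
    simp only [hW, mem_union, mem_symmDiff] at *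
    grind
  rw [← card_singleton q, card_eq (A ∩ B') (by grind), card_eq (A' ∩ B) (by grind),
    card_eq (A ∩ B) (by grind), card_eq (A' ∩ B') (by grind),
    card_eq (symmDiff x A ∩ _) (by intro a; simp [hW, mem_symmDiff]; tauto),
    card_eq (symmDiff x A' ∩ _) (by intro a; simp [hW, mem_symmDiff]; tauto),
    card_eq {q} hqW]
  simp only [← sum_add_distrib]
  refine sum_le_sum fun a _ => ?_
  simp only [mem_inter, mem_symmDiff, mem_erase, mem_singleton] at *
  by_cases h₁ : a ∈ A <;> by_cases h₂ : a ∈ B <;> by_cases h₃ : a ∈ A' <;>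
    by_cases h₄ : a ∈ B' <;> by_cases h₅ : a ∈ x <;> simp [h₁, h₂, h₃, h₄, h₅] <;> grind

lemma card_symmDiff_add_two_mul_card_inter {α : Type*} [DecidableEq α] (A B : Finset α) :
    (symmDiff A B).card + 2 * (A ∩ B).card = A.card + B.card := by
  have h₁ := Finset.card_sdiff_add_card_inter A B
  have h₂ := Finset.card_sdiff_add_card_inter B A
  rw [Finset.inter_comm] at h₂
  have h₃ : (symmDiff A B).card = (A \ B).card + (B \ A).card :=
    Finset.card_union_of_disjoint disjoint_sdiff_sdiff
  omega

open Finset in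
/-- Sphere packing bound for pairs of sets. -/
lemma card_mul_sum_choose_le (s k ℓ : ℕ) (hlk : ℓ ≤ k) (hks : 2 * (k + 1) ≤ s)
    {α ι : Type*} [DecidableEq α] [Fintype ι] (A B : ι → Finset α)
    (hAB : ∀ i, (A i).card + (B i).card = s)
    (hself : ∀ i, (A i ∩ B i).card ≤ ℓ)
    (hcross : ∀ i j, i ≠ j → 2 * (k + 1) ≤ (A i ∩ B j).card + (A j ∩ B i).card) :
    Fintype.card ι * ∑ i ∈ range (k - ℓ + 1), (s - 2 * ℓ - 1).choose i
      ≤ 2 ^ (s - 2 * ℓ - 1) := by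
  have hcard i := card_symmDiff_add_two_mul_card_inter (A i) (B i)
  have hne i : (symmDiff (A i) (B i)).Nonempty := by
    rw [← card_pos]
    have := hcard i
    have := hAB i
    have := hself i
    omega
  choose p hp hmin using fun i => exists_min_image _ (embeddingToCardinal : α ↪ Cardinal) (hne i)
  set U : Finset α := univ.biUnion fun i => A i ∪ B i
  have hU i : A i ∪ B i ⊆ U := subset_biUnion_of_mem (fun i => A i ∪ B i) (mem_univ i)
  let E i := U.powerset.filter fun x =>
    (symmDiff x (A i) ∩ (symmDiff (A i) (B i)).erase (p i)).card ≤ k - (A i ∩ B i).card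
  have hdisj : Set.PairwiseDisjoint (univ : Finset ι) E := by
    intro i _ j _ hij
    rw [Function.onFun, disjoint_left]
    intro x hi hj
    have hi := (mem_filter.1 hi).2
    have hj := (mem_filter.1 hj).2
    have := card_cross_inter_le (A i) (B i) (A j) (B j) x (p i) (p j) (hp i) (hp j)
      fun h₁ h₂ => embeddingToCardinal.injective ((hmin i _ h₂).antisymm (hmin j _ h₁))
    have := hcross i j hij
    have := hself i
    have := hself j
    omega
  have hE i : 2 ^ U.card * ∑ i ∈ range (k - ℓ + 1), (s - 2 * ℓ - 1).choose i
      ≤ 2 ^ (s - 2 * ℓ - 1) * (E i).card := by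
    have hsub : (symmDiff (A i) (B i)).erase (p i) ⊆ U :=
      (erase_subset _ _).trans (symmDiff_le_sup.trans (hU i))
    have hle := le_card_filter_symmDiff_inter U _ (A i) hsub (subset_union_left.trans (hU i))
      (k - (A i ∩ B i).card)
    have hsc := card_le_card hsub
    have h₁ := hcard i
    have h₂ := hAB i
    have h₃ := hself i
    obtain ⟨r, hr⟩ := Nat.exists_eq_add_of_le h₃
    have hS : ((symmDiff (A i) (B i)).erase (p i)).card = s - 2 * ℓ - 1 + 2 * r := by
      rw [card_erase_of_mem (hp i)]
      omega
    rw [hS] at hle hsc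
    have hball := two_pow_mul_sum_choose_le (s - 2 * ℓ - 1) (k - ℓ) r (by omega)
    rw [show k - ℓ + r = k - (A i ∩ B i).card by omega] at hball
    calc _ = 2 ^ (s - 2 * ℓ - 1) * ((2 ^ (2 * r) *
            ∑ i ∈ range (k - ℓ + 1), (s - 2 * ℓ - 1).choose i)
            * 2 ^ (U.card - (s - 2 * ℓ - 1 + 2 * r))) := by
          conv_lhs => rw [← Nat.add_sub_cancel' hsc, pow_add, pow_add]
          ring
      _ ≤ _ := Nat.mul_le_mul_left _ ((Nat.mul_le_mul_right _ hball).trans hle)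
  have hsum : ∑ i, (E i).card ≤ 2 ^ U.card := by
    rw [← card_biUnion hdisj, ← card_powerset]
    exact card_le_card (biUnion_subset.2 fun i _ => filter_subset _ _)
  refine Nat.le_of_mul_le_mul_left ?_ (Nat.two_pow_pos U.card)
  calc _ = ∑ _i : ι, 2 ^ U.card * ∑ i ∈ range (k - ℓ + 1), (s - 2 * ℓ - 1).choose i := by
        rw [sum_const, card_univ, smul_eq_mul]
        ring
    _ ≤ ∑ i, 2 ^ (s - 2 * ℓ - 1) * (E i).card := sum_le_sum fun i _ => hE i
    _ ≤ 2 ^ (s - 2 * ℓ - 1) * 2 ^ U.card := by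
        rw [← mul_sum]
        exact Nat.mul_le_mul_left _ hsum
    _ = _ := mul_comm _ _

lemma sum_range_choose_le_two_pow (n c : ℕ) : ∑ i ∈ Finset.range c, n.choose i ≤ 2 ^ n := by
  rw [← Nat.sum_range_choose]
  refine Finset.sum_le_sum_of_ne_zero fun i _ hi => ?_
  rw [Finset.mem_range]
  by_contra h
  exact hi (Nat.choose_eq_zero_of_lt (by omega))

theorem stmt_11 (s k ℓ : ℕ) (hlk : ℓ ≤ k) (hks : k < s)
    (α : Type*) [DecidableEq α] (m : ℕ) (A B : Fin m → Finset α)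
    (hAB : ∀ i, (A i).card + (B i).card = s)
    (hself : ∀ i, (A i ∩ B i).card ≤ ℓ)
    (hcross : ∀ i j : Fin m, i < j →
      2 * (k + 1) ≤ (A i ∩ B j).card + (A j ∩ B i).card) :
    (m : ℝ) ≤ 2 ^ (s - 2 * ℓ - 1) /
      ∑ i ∈ Finset.range (k - ℓ + 1), ((s - 2 * ℓ - 1).choose i : ℝ) := by
  have hpos : 0 < ∑ i ∈ Finset.range (k - ℓ + 1), (s - 2 * ℓ - 1).choose i :=
    Finset.sum_pos' (fun _ _ => Nat.zero_le _) ⟨0, by simp, by simp⟩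
  suffices h : m * ∑ i ∈ Finset.range (k - ℓ + 1), (s - 2 * ℓ - 1).choose i
      ≤ 2 ^ (s - 2 * ℓ - 1) by
    rw [le_div_iff₀ (by exact_mod_cast hpos)]
    exact_mod_cast h
  obtain hm | hm := Nat.lt_or_ge 1 m
  · have hs : 2 * (k + 1) ≤ s := by
      let i : Fin m := ⟨0, by omega⟩
      let j : Fin m := ⟨1, hm⟩
      have h := hcross i j (by simp [i, j])
      have h₁ := Finset.card_le_card (Finset.inter_subset_left : A i ∩ B j ⊆ A i)
      have h₂ := Finset.card_le_card (Finset.inter_subset_right : A j ∩ B i ⊆ B i)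
      have := hAB i
      omega
    have h := card_mul_sum_choose_le s k ℓ hlk hs A B hAB hself fun i j hij => by
      obtain hlt | hlt := lt_or_gt_of_ne hij
      · exact hcross i j hlt
      · rw [add_comm (Finset.card _)]
        exact hcross j i hlt
    rwa [Fintype.card_fin] at h
  · exact (Nat.mul_le_mul_right _ hm).trans
      ((one_mul _).trans_le (sum_range_choose_le_two_pow _ _))
end
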